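/- arXiv:1001.5404 — 2 statements merged into one kernel-verified Lean document; each statement's English description precedes it below -/
import Mathlib

section
/- (Adequacy, soundness direction) Let R be a TRS with simulating GRS G(R), let S be a term graph with term(S) = s, and let p be a position. If S ▷_p^! U, U ⊐_p^! V and V ⇒_{G(R),p} T for term graphs U, V, T, then s →_{R,p} term(T), i.e. s rewrites in R at position p to the term represented by T. -/
namespace TermGraphs

/-- First-order terms over a signature `F` and variables `V`. -/
inductive Tm (F V : Type) : Type
  | var : V → Tm F V
  | app : F → List (Tm F V) → Tm F V

/-- A (pre-)graph over labels `L`: a finite set of nodes (drawn from `ℕ`),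
a successor map assigning each node an ordered sequence of nodes,
a labelling, and a designated root node. -/
structure PreGraph (L : Type) where
  nodes : Finset ℕ
  suc : ℕ → List ℕ
  lab : ℕ → L
  root : ℕ

variable {F V L : Type}

/-- The edge relation of a graph: `u → v` iff `v` occurs in `suc u`. -/
def Edge (G : PreGraph L) (u v : ℕ) : Prop := u ∈ G.nodes ∧ v ∈ G.suc u

/-- `v` is reachable from `u` in `G`. -/
def Reach (G : PreGraph L) : ℕ → ℕ → Prop := Relation.ReflTransGen (Edge G)

/-- `ReachesP G u p v`: starting in `u` and following the position `p`
(a sequence of argument indices) one reaches the node `v`. -/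
inductive ReachesP (G : PreGraph L) : ℕ → List ℕ → ℕ → Prop
  | nil (u : ℕ) : ReachesP G u [] u
  | cons {u v w : ℕ} {i : ℕ} {p : List ℕ} :
      u ∈ G.nodes → (G.suc u)[i]? = some v → ReachesP G v p w →
      ReachesP G u (i :: p) w

/-- `p` is a position of the node `u` in `G`, i.e. `p ∈ Pos_G(u)`. -/
def IsPos (G : PreGraph L) (u : ℕ) (p : List ℕ) : Prop := ReachesP G G.root p u

/-- A node is unshared if its set of positions is a singleton. -/
def Unshared (G : PreGraph L) (u : ℕ) : Prop := ∃! p, IsPos G u p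

/-- A node `u` is strictly below the position `p` if `p` is a proper prefix of
some position of `u`. -/
def StrictlyBelow (G : PreGraph L) (p : List ℕ) (u : ℕ) : Prop :=
  ∃ q, IsPos G u q ∧ p <+: q ∧ p ≠ q

open Classical in
/-- `S↾u`, the subgraph of `S` reachable from the node `u`. -/
noncomputable def subgraph (G : PreGraph L) (u : ℕ) : PreGraph L where
  nodes := G.nodes.filter fun v => Reach G u v
  suc := G.suc
  lab := G.lab
  root := u

/-- The union `G ∪ H` of two graphs (for properly sharing graphs this
is symmetric on the common nodes). -/
def gUnion (G H : PreGraph L) : PreGraph L where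
  nodes := G.nodes ∪ H.nodes
  suc := fun u => if u ∈ G.nodes then G.suc u else H.suc u
  lab := fun u => if u ∈ G.nodes then G.lab u else H.lab u
  root := G.root

/-- Two graphs are properly sharing if every common node carries the same
label and the same successor sequence in both. -/
def ProperlySharing (G H : PreGraph L) : Prop :=
  ∀ u, u ∈ G.nodes → u ∈ H.nodes → G.lab u = H.lab u ∧ G.suc u = H.suc u

/-- The redirection `G[u ≫ v]`: the node `u` is removed (and `v` added), and
`u` is replaced by `v` in all successor sequences. -/
def redirect (G : PreGraph L) (u v : ℕ) : PreGraph L where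
  nodes := insert v (G.nodes.erase u)
  suc := fun w => (G.suc w).map fun x => if x = u then v else x
  lab := G.lab
  root := if G.root = u then v else G.root

/-- The replacement `G[u ← H]`: the subgraph of `G[u ≫ root(H)] ∪ H` reachable
from `root(H)` if `u = root(G)`, and from `root(G)` otherwise. -/
noncomputable def replaceAt (G : PreGraph L) (u : ℕ) (H : PreGraph L) : PreGraph L :=
  subgraph (gUnion H (redirect G u H.root)) (if u = G.root then H.root else G.root)

/-- A term graph over the signature `F` (with arities `ar`) and variables `V`:
an acyclic rooted graph whose nodes are labelled by function symbols or
variables, such that a node labelled by `f` has `ar f` successors, a node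
labelled by a variable has no successors, and variable nodes are shared. -/
structure IsTermGraph (ar : F → ℕ) (G : PreGraph (F ⊕ V)) : Prop where
  closed : ∀ u ∈ G.nodes, ∀ v ∈ G.suc u, v ∈ G.nodes
  acyclic : ∀ u v : ℕ, Relation.TransGen (Edge G) u v → u ≠ v
  rootMem : G.root ∈ G.nodes
  rootReach : ∀ u ∈ G.nodes, Reach G G.root u
  funArity : ∀ u ∈ G.nodes, ∀ f : F, G.lab u = Sum.inl f → (G.suc u).length = ar f
  varSuc : ∀ u ∈ G.nodes, ∀ x : V, G.lab u = Sum.inr x → G.suc u = []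
  varShared : ∀ u ∈ G.nodes, ∀ v ∈ G.nodes, ∀ x : V,
      G.lab u = Sum.inr x → G.lab v = Sum.inr x → u = v

/-- Fuelled computation of the term represented by (the subgraph at) a node.
For a term graph, any fuel strictly exceeding the length of the longest
path suffices; acyclicity bounds path lengths by the number of nodes. -/
noncomputable def termAt [Inhabited V] (G : PreGraph (F ⊕ V)) : ℕ → ℕ → Tm F V
  | 0, _ => Tm.var default
  | fuel + 1, u =>
    match G.lab u with
    | Sum.inr x => Tm.var x
    | Sum.inl f => Tm.app f ((G.suc u).map fun v => termAt G fuel v)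

/-- `term(G)`, the term represented by the term graph `G`. -/
noncomputable def termOf [Inhabited V] (G : PreGraph (F ⊕ V)) : Tm F V :=
  termAt G (G.nodes.card + 1) G.root

/-- Application of a substitution `σ : V → Tm F V` to a term. -/
def substTm (σ : V → Tm F V) : Tm F V → Tm F V
  | Tm.var x => σ x
  | Tm.app f ts => Tm.app f (ts.attach.map fun t => substTm σ t.1)
decreasing_by
  have := List.sizeOf_lt_of_mem t.2
  simp only [Tm.app.sizeOf_spec]
  omega

/-- The variable `x` occurs in the term `t`. -/
inductive OccursIn (x : V) : Tm F V → Prop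
  | var : OccursIn x (Tm.var x)
  | app {f : F} {ts : List (Tm F V)} {t : Tm F V} :
      t ∈ ts → OccursIn x t → OccursIn x (Tm.app f ts)

/-- A morphism `m : L → S` of term graphs: it maps nodes to nodes, root to
root, and preserves labels and successor sequences at every node of `L`
labelled by a function symbol. -/
structure IsMorphism (L S : PreGraph (F ⊕ V)) (m : ℕ → ℕ) : Prop where
  maps : ∀ u ∈ L.nodes, m u ∈ S.nodes
  root : m L.root = S.root
  lab : ∀ u ∈ L.nodes, ∀ f : F, L.lab u = Sum.inl f → S.lab (m u) = Sum.inl f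
  suc : ∀ u ∈ L.nodes, ∀ f : F, L.lab u = Sum.inl f → S.suc (m u) = (L.suc u).map m

/-- `S ≥_m T`: `m` is a morphism whose label and successor conditions hold at
*all* nodes of `S`, including variable nodes. -/
structure IsGeMorph (S T : PreGraph (F ⊕ V)) (m : ℕ → ℕ) : Prop where
  maps : ∀ u ∈ S.nodes, m u ∈ T.nodes
  root : m S.root = T.root
  lab : ∀ u ∈ S.nodes, T.lab (m u) = S.lab u
  suc : ∀ u ∈ S.nodes, T.suc (m u) = (S.suc u).map m

open Classical in
/-- The substitution `σ_m` induced by a morphism `m : L → S`: a variable `x`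
labelling the (unique) node `u` of `L` is mapped to `term(S↾m(u))`. -/
noncomputable def inducedSubst [Inhabited V] (L S : PreGraph (F ⊕ V)) (m : ℕ → ℕ) :
    V → Tm F V := fun x =>
  if h : ∃ u, u ∈ L.nodes ∧ L.lab u = Sum.inr x then
    termOf (subgraph S (m h.choose))
  else Tm.var x

/-- `S ⊒_{u,v} T` (for nodes `u ≽ v` of `S`, taking `≻` to be the usual order
on `ℕ`): `S ≥_m T` for the morphism `m` with `m u = v` and `m w = w` for all
other nodes `w`. -/
def Collapse (S T : PreGraph (F ⊕ V)) (u v : ℕ) : Prop :=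
  u ∈ S.nodes ∧ v ∈ S.nodes ∧ v ≤ u ∧
    IsGeMorph S T (fun w => if w = u then v else w)

/-- `S ⊐_{u,v} T`: `S ⊒_{u,v} T` with `u ≠ v`. -/
def CollapseS (S T : PreGraph (F ⊕ V)) (u v : ℕ) : Prop :=
  Collapse S T u v ∧ u ≠ v

/-- The single-step folding relation `S ⊐ T`. -/
def Fold (S T : PreGraph (F ⊕ V)) : Prop := ∃ u v, CollapseS S T u v

/-- `S ⊐_p T`: `S` folds strictly below the position `p` to `T`. -/
def FoldBelow (p : List ℕ) (S T : PreGraph (F ⊕ V)) : Prop :=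
  ∃ u v, CollapseS S T u v ∧ StrictlyBelow S p u ∧ StrictlyBelow S p v

/-- `S ▷_p T`: `S` unfolds above the position `p` to `T`, i.e. `T ⊐_{u,v} S`
for some node `u` of `T` that is unshared in `T` and whose unique position is
a prefix of `p`. -/
def UnfoldAbove (p : List ℕ) (S T : PreGraph (F ⊕ V)) : Prop :=
  ∃ u v, CollapseS T S u v ∧ ∃ q, q <+: p ∧ (∀ q', IsPos T u q' ↔ q' = q)

/-- The relation `⊐` restricted to term graphs. -/
def FoldTG (ar : F → ℕ) (S T : PreGraph (F ⊕ V)) : Prop :=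
  IsTermGraph ar S ∧ IsTermGraph ar T ∧ Fold S T

/-- The relation `⊐_p` restricted to term graphs. -/
def FoldBelowTG (ar : F → ℕ) (p : List ℕ) (S T : PreGraph (F ⊕ V)) : Prop :=
  IsTermGraph ar S ∧ IsTermGraph ar T ∧ FoldBelow p S T

/-- The relation `▷_p` restricted to term graphs. -/
def UnfoldAboveTG (ar : F → ℕ) (p : List ℕ) (S T : PreGraph (F ⊕ V)) : Prop :=
  IsTermGraph ar S ∧ IsTermGraph ar T ∧ UnfoldAbove p S T

/-- `a →^! b` for an abstract relation `r`: `a r^* b` and `b` is `r`-minimal. -/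
def NormTo {α : Type _} (r : α → α → Prop) (a b : α) : Prop :=
  Relation.ReflTransGen r a b ∧ ∀ c, ¬ r b c

/-- The `n`-fold composition of an abstract relation. -/
def Iter {α : Type _} (r : α → α → Prop) : ℕ → α → α → Prop
  | 0 => Eq
  | n + 1 => fun a c => ∃ b, r a b ∧ Iter r n b c

/-- The node `u` of `G` is labelled by a variable. -/
def IsVarNode (G : PreGraph (F ⊕ V)) (u : ℕ) : Prop := ∃ x : V, G.lab u = Sum.inr x

/-- A graph rewrite rule `L → R`: `L` and `R` are properly sharing term
graphs, `root(L)` is not a variable node, every variable of `R` occurs in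
`L`, and `root(L)` is not a node of `R`. -/
structure IsRule (ar : F → ℕ) (Lhs Rhs : PreGraph (F ⊕ V)) : Prop where
  lhs : IsTermGraph ar Lhs
  rhs : IsTermGraph ar Rhs
  sharing : ProperlySharing Lhs Rhs
  rootNotVar : ¬ IsVarNode Lhs Lhs.root
  varsSub : ∀ x : V, (∃ u ∈ Rhs.nodes, Rhs.lab u = Sum.inr x) →
      (∃ u ∈ Lhs.nodes, Lhs.lab u = Sum.inr x)
  rootNotInRhs : Lhs.root ∉ Rhs.nodes

/-- `m(R)`: the graph obtained from `R` by replacing every node `v` in the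
domain `dom` of the morphism `m` by `m v`; the replaced nodes keep the labels
and successor sequences they have in `S`. -/
def applyMorph (dom : Finset ℕ) (m : ℕ → ℕ) (S R : PreGraph (F ⊕ V)) :
    PreGraph (F ⊕ V) where
  nodes := R.nodes.image fun v => if v ∈ dom then m v else v
  suc := fun w => if w ∈ S.nodes then S.suc w
                  else (R.suc w).map fun x => if x ∈ dom then m x else x
  lab := fun w => if w ∈ S.nodes then S.lab w else R.lab w
  root := if R.root ∈ dom then m R.root else R.root

/-- `φ` exhibits `G'` as an isomorphic copy of `G`. -/
structure GIsoOn (φ : ℕ → ℕ) (G G' : PreGraph (F ⊕ V)) : Prop where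
  nodes : G'.nodes = G.nodes.image φ
  root : φ G.root = G'.root
  lab : ∀ u ∈ G.nodes, G'.lab (φ u) = G.lab u
  suc : ∀ u ∈ G.nodes, G'.suc (φ u) = (G.suc u).map φ

/-- `L' → R'` is a renaming of the rule `L → R` with respect to `S`: an
isomorphic copy that is node-disjoint from `S`. -/
def IsRenaming (L R L' R' S : PreGraph (F ⊕ V)) : Prop :=
  ∃ φ : ℕ → ℕ, Set.InjOn φ ↑(L.nodes ∪ R.nodes) ∧
    GIsoOn φ L L' ∧ GIsoOn φ R R' ∧ Disjoint (L'.nodes ∪ R'.nodes) S.nodes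

/-- `S ⇒_{G,u} T`: a graph rewrite step at the node `u`, using a renaming
`L' → R'` of some rule of `G`, a morphism `m : L' → S↾u`, and
`T = S[u ← m(R')]`. -/
def GStepAt (G : Set (PreGraph (F ⊕ V) × PreGraph (F ⊕ V))) (u : ℕ)
    (S T : PreGraph (F ⊕ V)) : Prop :=
  ∃ LR ∈ G, ∃ L' R' : PreGraph (F ⊕ V), ∃ m : ℕ → ℕ,
    IsRenaming LR.1 LR.2 L' R' S ∧
    IsMorphism L' (subgraph S u) m ∧
    T = replaceAt S u (applyMorph L'.nodes m S R')

/-- `S ⇒_{G,p} T`: a graph rewrite step at the node corresponding to the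
position `p`. -/
def GStepP (G : Set (PreGraph (F ⊕ V) × PreGraph (F ⊕ V))) (p : List ℕ)
    (S T : PreGraph (F ⊕ V)) : Prop :=
  ∃ u, IsPos S u p ∧ GStepAt G u S T

/-- A term rewrite system: a finite set of rules `l → r` where `l` is not a
variable and every variable of `r` occurs in `l`. -/
def IsTRS (R : Set (Tm F V × Tm F V)) : Prop :=
  R.Finite ∧ ∀ lr ∈ R, (∀ x : V, lr.1 ≠ Tm.var x) ∧
    ∀ x : V, OccursIn x lr.2 → OccursIn x lr.1

/-- `s →_{R,p} t`: a rewrite step of the TRS `R` at position `p`. -/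
inductive RewriteAt (R : Set (Tm F V × Tm F V)) : List ℕ → Tm F V → Tm F V → Prop
  | root {l r : Tm F V} (σ : V → Tm F V) :
      (l, r) ∈ R → RewriteAt R [] (substTm σ l) (substTm σ r)
  | congr {i : ℕ} {p : List ℕ} {f : F} {ts : List (Tm F V)} {t t' : Tm F V} :
      ts[i]? = some t → RewriteAt R p t t' →
      RewriteAt R (i :: p) (Tm.app f ts) (Tm.app f (ts.set i t'))

/-- A graph is minimally sharing if every node is a variable node or unshared. -/
def MinimallySharing (G : PreGraph (F ⊕ V)) : Prop :=
  ∀ u ∈ G.nodes, IsVarNode G u ∨ Unshared G u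

/-- A graph is maximally sharing if distinct nodes represent distinct terms. -/
def MaximallySharing [Inhabited V] (G : PreGraph (F ⊕ V)) : Prop :=
  ∀ u ∈ G.nodes, ∀ v ∈ G.nodes,
    termOf (subgraph G u) = termOf (subgraph G v) → u = v

/-- `G ∈ Tree(s)`: `G` is a minimally sharing term graph representing `s`. -/
def InTree [Inhabited V] (ar : F → ℕ) (s : Tm F V) (G : PreGraph (F ⊕ V)) : Prop :=
  IsTermGraph ar G ∧ MinimallySharing G ∧ termOf G = s

/-- `G ∈ Shared(s)`: `G` is a maximally sharing term graph representing `s`. -/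
def InShared [Inhabited V] (ar : F → ℕ) (s : Tm F V) (G : PreGraph (F ⊕ V)) : Prop :=
  IsTermGraph ar G ∧ MaximallySharing G ∧ termOf G = s

/-- `L → R` is a graph rewrite rule simulating the term rewrite rule `l → r`:
`L ∈ Tree(l)`, `R ∈ Tree(r)` and the common nodes of `L` and `R` are exactly
the variable nodes of `R`. -/
def SimRule [Inhabited V] (ar : F → ℕ) (l r : Tm F V)
    (Lg Rg : PreGraph (F ⊕ V)) : Prop :=
  IsRule ar Lg Rg ∧ InTree ar l Lg ∧ InTree ar r Rg ∧
    ∀ w : ℕ, (w ∈ Lg.nodes ∧ w ∈ Rg.nodes) ↔ (w ∈ Rg.nodes ∧ IsVarNode Rg w)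

/-- `G` is the simulating graph rewrite system `G(R)` of the TRS `R`. -/
def IsSimGRS [Inhabited V] (ar : F → ℕ) (R : Set (Tm F V × Tm F V))
    (G : Set (PreGraph (F ⊕ V) × PreGraph (F ⊕ V))) : Prop :=
  (∀ lr ∈ R, ∃ LR ∈ G, SimRule ar lr.1 lr.2 LR.1 LR.2) ∧
  (∀ LR ∈ G, ∃ lr ∈ R, SimRule ar lr.1 lr.2 LR.1 LR.2)

/-- `S ⇒ˢ_{G,p} T`: `S ▷_p^! U`, `U ⊐_p^! V` and `V ⇒_{G,p} T` for some
term graphs `U`, `V`. -/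
def SStepP (ar : F → ℕ) (G : Set (PreGraph (F ⊕ V) × PreGraph (F ⊕ V)))
    (p : List ℕ) (S T : PreGraph (F ⊕ V)) : Prop :=
  ∃ U Vg : PreGraph (F ⊕ V),
    NormTo (UnfoldAboveTG ar p) S U ∧ NormTo (FoldBelowTG ar p) U Vg ∧
    GStepP G p Vg T

/-- `S ⇒ˢ_G T`: an `⇒ˢ`-step at some position. -/
def SStep (ar : F → ℕ) (G : Set (PreGraph (F ⊕ V) × PreGraph (F ⊕ V)))
    (S T : PreGraph (F ⊕ V)) : Prop :=
  ∃ p : List ℕ, SStepP ar G p S T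

/-- `G` has a path of `n` edges. -/
def HasPathLen (G : PreGraph L) (n : ℕ) : Prop :=
  ∃ l : List ℕ, l.length = n + 1 ∧ l.Chain' (Edge G) ∧ ∀ x ∈ l, x ∈ G.nodes

/-- The depth of `G`: the length of the longest path in `G`. -/
noncomputable def depth (G : PreGraph L) : ℕ := sSup {n | HasPathLen G n}

/-- Filling every hole of a context (a term over `F ∪ {□}`, the hole `□`
being represented by `none`) with the term `t`. -/
def fillAll (t : Tm F V) : Tm (Option F) V → Tm F V
  | Tm.var x => Tm.var x
  | Tm.app none _ => t
  | Tm.app (some f) ts => Tm.app f (ts.attach.map fun c => fillAll t c.1)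
decreasing_by
  have := List.sizeOf_lt_of_mem c.2
  simp only [Tm.app.sizeOf_spec]
  omega

/-- Viewing a graph over `F ∪ V` as a graph over `(F ∪ {□}) ∪ V`. -/
def relabel (G : PreGraph (F ⊕ V)) : PreGraph (Option F ⊕ V) where
  nodes := G.nodes
  suc := G.suc
  lab := fun u => Sum.map some id (G.lab u)
  root := G.root

/-- The one-node graph consisting of a hole node `h` labelled `□`. -/
def holeGraph (h : ℕ) : PreGraph (Option F ⊕ V) where
  nodes := {h}
  suc := fun _ => []
  lab := fun _ => Sum.inl none
  root := h

/-! ### Terms represented by nodes -/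

/-- `Represents suc lab a t`: unravelling the graph with successor map `suc` and
labelling `lab` from the node `a` yields the finite term `t`. -/
inductive Represents (suc : ℕ → List ℕ) (lab : ℕ → F ⊕ V) : ℕ → Tm F V → Prop
  | var {a : ℕ} {x : V} : lab a = Sum.inr x → Represents suc lab a (Tm.var x)
  | app {a : ℕ} {f : F} {ts : List (Tm F V)} : lab a = Sum.inl f →
      ts.length = (suc a).length →
      (∀ (i : ℕ) (v : ℕ) (t : Tm F V), (suc a)[i]? = some v → ts[i]? = some t →
        Represents suc lab v t) →
      Represents suc lab a (Tm.app f ts)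

theorem Represents.unique {suc : ℕ → List ℕ} {lab : ℕ → F ⊕ V} {a : ℕ} {t t' : Tm F V}
    (h : Represents suc lab a t) (h' : Represents suc lab a t') : t = t' := by
  induction h generalizing t' with
  | var hl =>
    cases h' with
    | var hl' => rw [hl] at hl'; cases hl'; rfl
    | app hl' => rw [hl] at hl'; cases hl'
  | @app a f ts hl hlen _ ih =>
    cases h' with
    | var hl' => rw [hl] at hl'; cases hl'
    | @app _ f' ts' hl' hlen' hch' =>
      rw [hl] at hl'
      cases hl'
      congr 1
      apply List.ext_getElem (hlen.trans hlen'.symm)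
      intro i h1 h2
      have h3 : i < (suc a).length := hlen ▸ h1
      exact ih i _ _ (List.getElem?_eq_getElem h3) (List.getElem?_eq_getElem h1)
        (hch' i _ _ (List.getElem?_eq_getElem h3) (List.getElem?_eq_getElem h2))

/-- Edges issuing from nodes labelled by a function symbol. -/
def FunEdge (suc : ℕ → List ℕ) (lab : ℕ → F ⊕ V) (a b : ℕ) : Prop :=
  (∃ f, lab a = Sum.inl f) ∧ b ∈ suc a

theorem Represents.of_funEdge {suc : ℕ → List ℕ} {lab : ℕ → F ⊕ V} {a b : ℕ} {t : Tm F V}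
    (h : Represents suc lab a t) (hab : Relation.TransGen (FunEdge suc lab) a b) :
    ∃ t', Represents suc lab b t' ∧ sizeOf t' < sizeOf t := by
  have step : ∀ {a b : ℕ} {t : Tm F V}, Represents suc lab a t → FunEdge suc lab a b →
      ∃ t', Represents suc lab b t' ∧ sizeOf t' < sizeOf t := by
    rintro a b t h ⟨⟨f, hf⟩, hb⟩
    cases h with
    | var hl => rw [hf] at hl; cases hl
    | @app _ f' ts hl hlen hch =>
      obtain ⟨i, hi, rfl⟩ := List.getElem_of_mem hb
      have hi' : i < ts.length := hlen ▸ hi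
      refine ⟨ts[i], hch i _ _ (List.getElem?_eq_getElem hi) (List.getElem?_eq_getElem hi'), ?_⟩
      have := List.sizeOf_lt_of_mem (List.getElem_mem hi')
      simp only [Tm.app.sizeOf_spec]
      omega
  induction hab with
  | single h1 => exact step h h1
  | tail _ h2 ih =>
    obtain ⟨t1, ht1, hlt⟩ := ih
    obtain ⟨t2, ht2, hlt2⟩ := step ht1 h2
    exact ⟨t2, ht2, hlt2.trans hlt⟩

open Classical in
theorem Represents.termAt_eq [Inhabited V] {G : PreGraph (F ⊕ V)}
    (hc : ∀ u ∈ G.nodes, ∀ v ∈ G.suc u, v ∈ G.nodes) {a : ℕ} {t : Tm F V}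
    (h : Represents G.suc G.lab a t) (ha : a ∈ G.nodes) (n : ℕ)
    (hn : (G.nodes.filter (Relation.TransGen (FunEdge G.suc G.lab) a)).card < n) :
    termAt G n a = t := by
  induction h generalizing n with
  | var hl =>
    obtain ⟨k, rfl⟩ := Nat.exists_eq_succ_of_ne_zero (Nat.ne_zero_of_lt hn)
    simp [termAt, hl]
  | @app a f ts hl hlen hch ih =>
    obtain ⟨k, rfl⟩ := Nat.exists_eq_succ_of_ne_zero (Nat.ne_zero_of_lt hn)
    simp only [termAt, hl]
    congr 1
    apply List.ext_getElem (by simp [hlen])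
    intro i h1 h2
    have h3 : i < (G.suc a).length := hlen ▸ h2
    have hmem : (G.suc a)[i] ∈ G.suc a := List.getElem_mem h3
    have hE : FunEdge G.suc G.lab a (G.suc a)[i] := ⟨⟨f, hl⟩, hmem⟩
    rw [List.getElem_map]
    have hrep := hch i _ _ (List.getElem?_eq_getElem h3) (List.getElem?_eq_getElem h2)
    refine ih i _ _ (List.getElem?_eq_getElem h3) (List.getElem?_eq_getElem h2)
      (hc a ha _ hmem) k ?_
    refine lt_of_lt_of_le (Finset.card_lt_card ?_) (Nat.lt_succ_iff.mp hn)
    rw [Finset.ssubset_iff_of_subset]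
    · refine ⟨(G.suc a)[i], ?_, ?_⟩
      · simpa using ⟨hc a ha _ hmem, Relation.TransGen.single hE⟩
      · intro hcon
        obtain ⟨t', ht', hlt⟩ := hrep.of_funEdge (Finset.mem_filter.mp hcon).2
        rw [ht'.unique hrep] at hlt
        exact lt_irrefl _ hlt
    · intro x hx
      rw [Finset.mem_filter] at hx ⊢
      exact ⟨hx.1, Relation.TransGen.head hE hx.2⟩

theorem Represents.termOf_eq [Inhabited V] {G : PreGraph (F ⊕ V)}
    (hc : ∀ u ∈ G.nodes, ∀ v ∈ G.suc u, v ∈ G.nodes) {t : Tm F V}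
    (h : Represents G.suc G.lab G.root t) (hr : G.root ∈ G.nodes) : termOf G = t := by
  classical
  exact h.termAt_eq hc hr _ (Nat.lt_succ_of_le (Finset.card_filter_le _ _))

theorem IsTermGraph.exists_represents {ar : F → ℕ} {G : PreGraph (F ⊕ V)}
    (hG : IsTermGraph ar G) {a : ℕ} (ha : a ∈ G.nodes) :
    ∃ t, Represents G.suc G.lab a t := by
  classical
  induction hn : (G.nodes.filter (Relation.TransGen (Edge G) a)).card
    using Nat.strong_induction_on generalizing a with
  | _ n ih =>
    subst hn
    cases hl : G.lab a with
    | inr x => exact ⟨_, .var hl⟩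
    | inl f =>
      have hch : ∀ b, ∃ t, b ∈ G.suc a → Represents G.suc G.lab b t := by
        intro b
        by_cases hb : b ∈ G.suc a
        · have hbn := hG.closed a ha b hb
          obtain ⟨t, ht⟩ := ih _ (Finset.card_lt_card (by
            rw [Finset.ssubset_iff_of_subset]
            · refine ⟨b, ?_, ?_⟩
              · simpa using ⟨hbn, Relation.TransGen.single ⟨ha, hb⟩⟩
              · intro hcon
                exact hG.acyclic _ _ (Finset.mem_filter.mp hcon).2 rfl
            · intro x hx
              rw [Finset.mem_filter] at hx ⊢
              exact ⟨hx.1, Relation.TransGen.head ⟨ha, hb⟩ hx.2⟩)) hbn rfl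
          exact ⟨t, fun _ => ht⟩
        · exact ⟨.app f [], fun h => absurd h hb⟩
      choose g hg using hch
      refine ⟨.app f ((G.suc a).map g), .app hl (by simp) ?_⟩
      intro i v t hv ht
      rw [List.getElem?_map, hv] at ht
      cases ht
      exact hg v (List.mem_of_getElem? hv)

theorem IsTermGraph.represents_termOf [Inhabited V] {ar : F → ℕ} {G : PreGraph (F ⊕ V)}
    (hG : IsTermGraph ar G) : Represents G.suc G.lab G.root (termOf G) := by
  obtain ⟨t, ht⟩ := hG.exists_represents hG.rootMem
  rwa [ht.termOf_eq hG.closed hG.rootMem]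

theorem substTm_app (σ : V → Tm F V) (f : F) (ts : List (Tm F V)) :
    substTm σ (Tm.app f ts) = Tm.app f (ts.map (substTm σ)) := by
  rw [substTm]
  simp

/-- A map preserving labels and successors of function nodes, and sending variable
nodes to instances under `σ`, sends every node to an instance under `σ`. -/
theorem Represents.map_subst {suc suc' : ℕ → List ℕ} {lab lab' : ℕ → F ⊕ V}
    (P : ℕ → Prop) (k : ℕ → ℕ) (σ : V → Tm F V)
    (hc : ∀ a, P a → ∀ b ∈ suc a, P b)
    (hf : ∀ a f, P a → lab a = Sum.inl f →
      lab' (k a) = Sum.inl f ∧ suc' (k a) = (suc a).map k)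
    (hv : ∀ a x, P a → lab a = Sum.inr x → Represents suc' lab' (k a) (σ x))
    {a : ℕ} {t : Tm F V} (h : Represents suc lab a t) (ha : P a) :
    Represents suc' lab' (k a) (substTm σ t) := by
  induction h with
  | var hl =>
    rw [substTm]
    exact hv _ _ ha hl
  | @app a f ts hl hlen _ ih =>
    obtain ⟨h1, h2⟩ := hf a f ha hl
    rw [substTm_app]
    refine .app h1 (by simp [h2, hlen]) ?_
    intro i v t hv' ht
    rw [h2, List.getElem?_map, Option.map_eq_some_iff] at hv'
    rw [List.getElem?_map, Option.map_eq_some_iff] at ht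
    obtain ⟨v0, hv0, rfl⟩ := hv'
    obtain ⟨t0, ht0, rfl⟩ := ht
    exact ih i v0 t0 hv0 ht0 (hc a ha _ (List.mem_of_getElem? hv0))

/-- A map preserving all labels and successors preserves represented terms. -/
theorem Represents.map {suc suc' : ℕ → List ℕ} {lab lab' : ℕ → F ⊕ V}
    (P : ℕ → Prop) (k : ℕ → ℕ)
    (hc : ∀ a, P a → ∀ b ∈ suc a, P b)
    (hf : ∀ a, P a → lab' (k a) = lab a ∧ suc' (k a) = (suc a).map k)
    {a : ℕ} {t : Tm F V} (h : Represents suc lab a t) (ha : P a) :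
    Represents suc' lab' (k a) t := by
  induction h with
  | var hl => exact .var ((hf _ ha).1.trans hl)
  | @app a f ts hl hlen _ ih =>
    obtain ⟨h1, h2⟩ := hf a ha
    refine .app (h1.trans hl) (by simp [h2, hlen]) ?_
    intro i v t hv' ht
    rw [h2, List.getElem?_map, Option.map_eq_some_iff] at hv'
    obtain ⟨v0, hv0, rfl⟩ := hv'
    exact ih i v0 t hv0 ht (hc a ha _ (List.mem_of_getElem? hv0))

theorem IsGeMorph.termOf_eq [Inhabited V] {ar : F → ℕ} {S T : PreGraph (F ⊕ V)} {m : ℕ → ℕ}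
    (hm : IsGeMorph S T m) (hS : IsTermGraph ar S) (hT : IsTermGraph ar T) :
    termOf T = termOf S := by
  have h := hS.represents_termOf.map (suc' := T.suc) (lab' := T.lab) (· ∈ S.nodes) m hS.closed
    (fun a ha => ⟨hm.lab a ha, hm.suc a ha⟩) hS.rootMem
  rw [hm.root] at h
  exact h.termOf_eq hT.closed hT.rootMem

/-! ### Positions -/

theorem ReachesP.unique {G : PreGraph L} {a b b' : ℕ} {p : List ℕ}
    (h : ReachesP G a p b) (h' : ReachesP G a p b') : b = b' := by
  induction h with
  | nil => cases h'; rfl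
  | cons _ hi _ ih =>
    cases h' with
    | cons _ hi' h2 =>
      rw [hi] at hi'
      cases hi'
      exact ih h2

theorem ReachesP.append {G : PreGraph L} {a b c : ℕ} {p q : List ℕ}
    (h : ReachesP G a p b) (h' : ReachesP G b q c) : ReachesP G a (p ++ q) c := by
  induction h with
  | nil => exact h'
  | cons hn hi _ ih => exact .cons hn hi (ih h')

theorem ReachesP.snoc {G : PreGraph L} {a b c i : ℕ} {p : List ℕ}
    (h : ReachesP G a p b) (hb : b ∈ G.nodes) (hi : (G.suc b)[i]? = some c) :
    ReachesP G a (p ++ [i]) c :=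
  h.append (.cons hb hi (.nil c))

theorem ReachesP.of_snoc {G : PreGraph L} {a c i : ℕ} {p : List ℕ}
    (h : ReachesP G a (p ++ [i]) c) :
    ∃ b, ReachesP G a p b ∧ b ∈ G.nodes ∧ (G.suc b)[i]? = some c := by
  induction p generalizing a with
  | nil =>
    cases h with
    | cons hn hi h2 => cases h2; exact ⟨a, .nil a, hn, hi⟩
  | cons j p ih =>
    cases h with
    | cons hn hi h2 =>
      obtain ⟨b, hb, hb'⟩ := ih h2
      exact ⟨b, .cons hn hi hb, hb'⟩

theorem ReachesP.reach {G : PreGraph L} {a b : ℕ} {p : List ℕ}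
    (h : ReachesP G a p b) : Reach G a b := by
  induction h with
  | nil => exact .refl
  | cons hn hi _ ih => exact .head ⟨hn, List.mem_of_getElem? hi⟩ ih

theorem ReachesP.transGen {G : PreGraph L} {a b i : ℕ} {p : List ℕ}
    (h : ReachesP G a (i :: p) b) : Relation.TransGen (Edge G) a b := by
  cases h with
  | cons hn hi h2 => exact .head' ⟨hn, List.mem_of_getElem? hi⟩ h2.reach

theorem Reach.exists_reachesP {G : PreGraph L} {a b : ℕ} (h : Reach G a b) :
    ∃ p, ReachesP G a p b := by
  induction h with
  | refl => exact ⟨[], .nil a⟩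
  | tail _ he ih =>
    obtain ⟨p, hp⟩ := ih
    obtain ⟨i, hi⟩ := List.getElem?_of_mem he.2
    exact ⟨_, hp.snoc he.1 hi⟩

theorem IsTermGraph.mem_of_reachesP {ar : F → ℕ} {G : PreGraph (F ⊕ V)}
    (hG : IsTermGraph ar G) {a b : ℕ} {p : List ℕ} (h : ReachesP G a p b)
    (ha : a ∈ G.nodes) : b ∈ G.nodes := by
  induction h with
  | nil => exact ha
  | cons hn hi _ ih => exact ih (hG.closed _ hn _ (List.mem_of_getElem? hi))

theorem IsTermGraph.not_reach_of_transGen {ar : F → ℕ} {G : PreGraph (F ⊕ V)}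
    (hG : IsTermGraph ar G) {a b : ℕ} (h : Relation.TransGen (Edge G) a b) :
    ¬ Reach G b a :=
  fun h' => hG.acyclic _ _ (h.trans_left h') rfl

theorem IsGeMorph.isPos {S T : PreGraph (F ⊕ V)} {m : ℕ → ℕ}
    (hm : IsGeMorph S T m) {b : ℕ} {p : List ℕ} (h : IsPos S b p) : IsPos T (m b) p := by
  have key : ∀ {a b : ℕ} {p : List ℕ}, ReachesP S a p b → ReachesP T (m a) p (m b) := by
    intro a b p h
    induction h with
    | nil => exact .nil _
    | cons hn hi _ ih =>
      refine .cons (hm.maps _ hn) ?_ ih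
      rw [hm.suc _ hn, List.getElem?_map, hi]
      rfl
  have := key h
  rwa [hm.root] at this

theorem IsGeMorph.isPos_lift {ar : F → ℕ} {S T : PreGraph (F ⊕ V)} {m : ℕ → ℕ}
    (hm : IsGeMorph S T m) (hS : IsTermGraph ar S) {b : ℕ} {p : List ℕ} (h : IsPos T b p) :
    ∃ c ∈ S.nodes, m c = b ∧ IsPos S c p := by
  have key : ∀ {p : List ℕ} {a b : ℕ}, a ∈ S.nodes → ReachesP T (m a) p b →
      ∃ c ∈ S.nodes, m c = b ∧ ReachesP S a p c := by
    intro p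
    induction p with
    | nil =>
      intro a b ha h
      cases h
      exact ⟨a, ha, rfl, .nil a⟩
    | cons i p ih =>
      intro a b ha h
      cases h with
      | cons hn hi h2 =>
        rw [hm.suc _ ha, List.getElem?_map, Option.map_eq_some_iff] at hi
        obtain ⟨v, hv, rfl⟩ := hi
        obtain ⟨c, hc, hcb, hp⟩ := ih (hS.closed _ ha _ (List.mem_of_getElem? hv)) h2
        exact ⟨c, hc, hcb, .cons ha hv hp⟩
  refine key hS.rootMem ?_
  rwa [hm.root]

theorem IsGeMorph.transGen {S T : PreGraph (F ⊕ V)} {m : ℕ → ℕ}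
    (hm : IsGeMorph S T m) {a b : ℕ} (h : Relation.TransGen (Edge S) a b) :
    Relation.TransGen (Edge T) (m a) (m b) := by
  refine Relation.TransGen.lift m (fun x y hxy => ⟨hm.maps _ hxy.1, ?_⟩) _ _ h
  rw [hm.suc _ hxy.1]
  exact List.mem_map_of_mem hxy.2

/-! ### Unfolding -/

/-- Duplicate the node `v` as the fresh node `u`, redirecting the `i`-th edge of `w` to `u`. -/
def unfoldEdge (G : PreGraph L) (w i v u : ℕ) : PreGraph L where
  nodes := insert u G.nodes
  suc := fun x => if x = u then G.suc v else if x = w then (G.suc w).set i u else G.suc x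
  lab := fun x => if x = u then G.lab v else G.lab x
  root := G.root

theorem unfoldEdge_isGeMorph {ar : F → ℕ} {G : PreGraph (F ⊕ V)} (hG : IsTermGraph ar G)
    {w i v u : ℕ} (hw : w ∈ G.nodes) (hi : (G.suc w)[i]? = some v) (hu : u ∉ G.nodes) :
    IsGeMorph (unfoldEdge G w i v u) G (fun x => if x = u then v else x) := by
  have hv : v ∈ G.nodes := hG.closed w hw v (List.mem_of_getElem? hi)
  have hid : ∀ x ∈ G.nodes, (G.suc x).map (fun x => if x = u then v else x) = G.suc x := by
    intro x hx
    conv_rhs => rw [← List.map_id (G.suc x)]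
    refine List.map_congr_left fun y hy => ?_
    have : y ≠ u := fun h => hu (h ▸ hG.closed x hx y hy)
    simp [this]
  constructor
  · intro x hx
    by_cases hxu : x = u
    · simpa [hxu] using hv
    · simpa [unfoldEdge, hxu] using hx
  · have : G.root ≠ u := fun h => hu (h ▸ hG.rootMem)
    simp [unfoldEdge, this]
  · intro x _
    by_cases hxu : x = u <;> simp [unfoldEdge, hxu]
  · intro x hx
    by_cases hxu : x = u
    · simp only [unfoldEdge, hxu, if_true]
      exact (hid v hv).symm
    · have hxG : x ∈ G.nodes := by simpa [unfoldEdge, hxu] using hx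
      by_cases hxw : x = w
      · subst hxw
        simp only [unfoldEdge, hxu, if_true, if_false]
        rw [List.map_set, hid x hxG]
        obtain ⟨hlt, hget⟩ := List.getElem?_eq_some_iff.mp hi
        simp [← hget]
      · simp only [unfoldEdge, hxu, hxw, if_false]
        exact (hid x hxG).symm

theorem unfoldEdge_edge {G : PreGraph L} {w i v u x y j : ℕ} (hu : u ∉ G.nodes)
    (hx : x ∈ G.nodes) (hj : (G.suc x)[j]? = some y) (hne : ¬ (x = w ∧ j = i)) :
    Edge (unfoldEdge G w i v u) x y := by
  have hxu : x ≠ u := fun h => hu (h ▸ hx)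
  refine ⟨Finset.mem_insert_of_mem hx, ?_⟩
  by_cases hxw : x = w
  · subst hxw
    have hji : i ≠ j := fun h => hne ⟨rfl, h.symm⟩
    simp only [unfoldEdge, hxu, if_true, if_false]
    refine List.mem_of_getElem? (i := j) ?_
    rw [List.getElem?_set_ne hji, hj]
  · simp only [unfoldEdge, hxu, hxw, if_false]
    exact List.mem_of_getElem? hj

theorem unfoldEdge_isTermGraph {ar : F → ℕ} {G : PreGraph (F ⊕ V)} (hG : IsTermGraph ar G)
    {w i v u : ℕ} {f : F} {q q' : List ℕ} (hw : w ∈ G.nodes)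
    (hi : (G.suc w)[i]? = some v) (hu : u ∉ G.nodes) (hf : G.lab v = Sum.inl f)
    (hq : ∀ q', IsPos G w q' → q' = q) (hvq : IsPos G v q') (hne : q' ≠ q ++ [i]) :
    IsTermGraph ar (unfoldEdge G w i v u) := by
  have hm := unfoldEdge_isGeMorph hG hw hi hu
  have hv : v ∈ G.nodes := hG.closed w hw v (List.mem_of_getElem? hi)
  have hnodes : ∀ x ∈ (unfoldEdge G w i v u).nodes, x = u ∨ x ∈ G.nodes := by
    intro x hx
    simpa [unfoldEdge] using hx
  have habove : ∀ x, Reach G G.root x → ¬ Reach G v x →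
      Reach (unfoldEdge G w i v u) G.root x := by
    intro x hx
    induction hx with
    | refl => intro _; exact .refl
    | @tail b c hb hbc ih =>
      intro hnv
      refine (ih fun h => hnv (h.tail hbc)).tail ?_
      obtain ⟨j, hj⟩ := List.getElem?_of_mem hbc.2
      refine unfoldEdge_edge hu hbc.1 hj ?_
      rintro ⟨rfl, rfl⟩
      rw [hi] at hj
      cases hj
      exact hnv .refl
  have hvreach : Reach (unfoldEdge G w i v u) G.root v := by
    rcases List.eq_nil_or_concat q' with rfl | ⟨q0, j, rfl⟩
    · have : G.root = v := ReachesP.unique (.nil _) hvq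
      rw [this]
      exact .refl
    · obtain ⟨b, hb, hbn, hj⟩ := ReachesP.of_snoc (p := q0) (i := j) (by simpa [IsPos] using hvq)
      have hbv : Edge G b v := ⟨hbn, List.mem_of_getElem? hj⟩
      refine (habove b hb.reach (hG.not_reach_of_transGen (.single hbv))).tail ?_
      refine unfoldEdge_edge hu hbn hj ?_
      rintro ⟨rfl, rfl⟩
      exact hne (by rw [hq _ hb]; simp)
  have hreach : ∀ x, Reach G G.root x → Reach (unfoldEdge G w i v u) G.root x := by
    intro x hx
    induction hx with
    | refl => exact .refl
    | @tail b c hb hbc ih =>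
      obtain ⟨j, hj⟩ := List.getElem?_of_mem hbc.2
      by_cases h : b = w ∧ j = i
      · obtain ⟨rfl, rfl⟩ := h
        rw [hi] at hj
        cases hj
        exact hvreach
      · exact ih.tail (unfoldEdge_edge hu hbc.1 hj h)
  have hwu : w ≠ u := fun h => hu (h ▸ hw)
  have hedge : Edge (unfoldEdge G w i v u) w u := by
    refine ⟨Finset.mem_insert_of_mem hw, ?_⟩
    simp only [unfoldEdge, hwu, if_true, if_false]
    obtain ⟨hlt, -⟩ := List.getElem?_eq_some_iff.mp hi
    exact List.mem_set hlt u
  constructor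
  · intro x hx y hy
    rcases hnodes x hx with rfl | hxG
    · simp only [unfoldEdge, if_true] at hy
      exact Finset.mem_insert_of_mem (hG.closed v hv y hy)
    · have hxu : x ≠ u := fun h => hu (h ▸ hxG)
      by_cases hxw : x = w
      · simp only [unfoldEdge, hxw, hwu, if_true, if_false] at hy
        rcases List.mem_or_eq_of_mem_set hy with h | rfl
        · exact Finset.mem_insert_of_mem (hG.closed w hw y h)
        · exact Finset.mem_insert_self _ _
      · simp only [unfoldEdge, hxw, hxu, if_false] at hy
        exact Finset.mem_insert_of_mem (hG.closed x hxG y hy)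
  · rintro x _ h rfl
    exact hG.acyclic _ _ (hm.transGen h) rfl
  · exact Finset.mem_insert_of_mem hG.rootMem
  · intro x hx
    rcases hnodes x hx with rfl | hxG
    · exact (hreach w (hG.rootReach w hw)).tail hedge
    · exact hreach x (hG.rootReach x hxG)
  · intro x hx g hg
    have := hG.funArity _ (hm.maps x hx) g (by rw [hm.lab x hx, hg])
    rwa [hm.suc x hx, List.length_map] at this
  · intro x hx y hy
    have := hG.varSuc _ (hm.maps x hx) y (by rw [hm.lab x hx, hy])
    rwa [hm.suc x hx, List.map_eq_nil_iff] at this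
  · have hvar : ∀ x ∈ (unfoldEdge G w i v u).nodes, ∀ z,
        (unfoldEdge G w i v u).lab x = Sum.inr z → x ∈ G.nodes ∧ G.lab x = Sum.inr z := by
      intro x hx z hz
      rcases hnodes x hx with rfl | hxG
      · simp [unfoldEdge, hf] at hz
      · have hxu : x ≠ u := fun h => hu (h ▸ hxG)
        exact ⟨hxG, by simpa [unfoldEdge, hxu] using hz⟩
    intro x hx y hy z hxz hyz
    obtain ⟨hx1, hx2⟩ := hvar x hx z hxz
    obtain ⟨hy1, hy2⟩ := hvar y hy z hyz
    exact hG.varShared x hx1 y hy1 z hx2 hy2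

theorem unfoldEdge_isPos_iff {ar : F → ℕ} {G : PreGraph (F ⊕ V)} (hG : IsTermGraph ar G)
    {w i v u : ℕ} {q : List ℕ} (hw : w ∈ G.nodes)
    (hi : (G.suc w)[i]? = some v) (hu : u ∉ G.nodes)
    (hT : IsTermGraph ar (unfoldEdge G w i v u))
    (hq : ∀ q', IsPos G w q' ↔ q' = q) (q' : List ℕ) :
    IsPos (unfoldEdge G w i v u) u q' ↔ q' = q ++ [i] := by
  have hm := unfoldEdge_isGeMorph hG hw hi hu
  have hv : v ∈ G.nodes := hG.closed w hw v (List.mem_of_getElem? hi)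
  have hwu : w ≠ u := fun h => hu (h ▸ hw)
  obtain ⟨hlt, -⟩ := List.getElem?_eq_some_iff.mp hi
  have hwsuc : (unfoldEdge G w i v u).suc w = (G.suc w).set i u := by simp [unfoldEdge, hwu]
  constructor
  · intro h
    rcases List.eq_nil_or_concat q' with rfl | ⟨q0, j, rfl⟩
    · have : G.root = u := ReachesP.unique (.nil _) h
      exact absurd (this ▸ hG.rootMem) hu
    · obtain ⟨b, hb, hbn, hj⟩ := ReachesP.of_snoc (p := q0) (i := j) (by simpa [IsPos] using h)
      have hbu : b ≠ u := by
        rintro rfl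
        simp only [unfoldEdge, if_true] at hj
        exact hu (hG.closed v hv _ (List.mem_of_getElem? hj))
      have hbG : b ∈ G.nodes := by simpa [unfoldEdge, hbu] using hbn
      have hbw : b = w := by
        by_contra hbw
        simp only [unfoldEdge, hbu, hbw, if_false] at hj
        exact hu (hG.closed b hbG _ (List.mem_of_getElem? hj))
      subst hbw
      have hji : j = i := by
        by_contra hji
        rw [hwsuc, List.getElem?_set_ne (fun h => hji h.symm)] at hj
        exact hu (hG.closed b hbG _ (List.mem_of_getElem? hj))
      have := hm.isPos hb
      simp only [hbu, if_false] at this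
      rw [(hq _).mp this, hji]
      simp
  · rintro rfl
    obtain ⟨c, hc, hcw, hp⟩ := hm.isPos_lift hT ((hq q).mpr rfl)
    have hcu : c ≠ u := by
      intro h
      simp only [h, if_true] at hcw
      exact hG.acyclic w w (.single ⟨hw, List.mem_of_getElem? (hi.trans (congrArg some hcw))⟩) rfl
    simp only [hcu, if_false] at hcw
    subst hcw
    refine ReachesP.snoc hp hc ?_
    rw [hwsuc]
    simp [hlt]

/-- In a graph that cannot be unfolded above `p`, function nodes at prefixes of `p`
are unshared. -/
theorem isPos_unique_of_unfold_minimal {ar : F → ℕ} {U : PreGraph (F ⊕ V)} {p : List ℕ}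
    (hU : IsTermGraph ar U) (hmin : ∀ c, ¬ UnfoldAboveTG ar p U c) {q : List ℕ}
    (hqp : q <+: p) {n : ℕ} {f : F} (hn : IsPos U n q) (hf : U.lab n = Sum.inl f) :
    ∀ q', IsPos U n q' → q' = q := by
  induction q using List.reverseRecOn generalizing n f with
  | nil =>
    intro q' hq'
    have hr : U.root = n := ReachesP.unique (.nil _) hn
    subst hr
    cases q' with
    | nil => rfl
    | cons i q' => exact absurd rfl (hU.acyclic _ _ (ReachesP.transGen hq'))
  | append_singleton q i ih =>
    obtain ⟨w, hw, hwn, hi⟩ := ReachesP.of_snoc hn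
    have hq : ∀ q', IsPos U w q' → q' = q := by
      cases hl : U.lab w with
      | inl g => exact ih ((List.prefix_append q [i]).trans hqp) hw hl
      | inr x =>
        rw [hU.varSuc w hwn x hl] at hi
        simp at hi
    intro q' hq'
    by_contra hne
    obtain ⟨u, hu⟩ := Finset.exists_nat_subset_range U.nodes
    have hfresh : u ∉ U.nodes := fun h => by simpa using hu h
    have hnU : n ∈ U.nodes := hU.closed w hwn n (List.mem_of_getElem? hi)
    have hnu : n < u := by simpa using hu hnU
    have hT := unfoldEdge_isTermGraph hU hwn hi hfresh hf hq hq' hne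
    refine hmin (unfoldEdge U w i n u) ⟨hU, hT, u, n,
      ⟨⟨Finset.mem_insert_self _ _, Finset.mem_insert_of_mem hnU, hnu.le,
        unfoldEdge_isGeMorph hU hwn hi hfresh⟩, hnu.ne'⟩, q ++ [i], hqp, ?_⟩
    exact unfoldEdge_isPos_iff hU hwn hi hfresh hT
      (fun q' => ⟨hq q', fun h => h ▸ hw⟩)

theorem UnfoldAboveTG.reflTransGen_inv [Inhabited V] {ar : F → ℕ} {p : List ℕ}
    {S U : PreGraph (F ⊕ V)} (hS : IsTermGraph ar S)
    (h : Relation.ReflTransGen (UnfoldAboveTG ar p) S U) :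
    IsTermGraph ar U ∧ termOf U = termOf S := by
  induction h with
  | refl => exact ⟨hS, rfl⟩
  | tail _ h ih =>
    obtain ⟨h1, h2, u, v, hc, -⟩ := h
    exact ⟨h2, (hc.1.2.2.2.termOf_eq h2 h1).symm.trans ih.2⟩

theorem FoldBelowTG.reflTransGen_inv [Inhabited V] {ar : F → ℕ} {p : List ℕ}
    {U W : PreGraph (F ⊕ V)} (hU : IsTermGraph ar U)
    (h : Relation.ReflTransGen (FoldBelowTG ar p) U W) :
    IsTermGraph ar W ∧ termOf W = termOf U := by
  induction h with
  | refl => exact ⟨hU, rfl⟩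
  | tail _ h ih =>
    obtain ⟨h1, h2, u, v, hc, -⟩ := h
    exact ⟨h2, (hc.1.2.2.2.termOf_eq h1 h2).trans ih.2⟩

theorem FoldBelowTG.isPos_lift {ar : F → ℕ} {p q : List ℕ} {U W : PreGraph (F ⊕ V)} {n : ℕ}
    {f : F} (h : Relation.ReflTransGen (FoldBelowTG ar p) U W) (hn : IsPos W n q)
    (hf : W.lab n = Sum.inl f) : ∃ n', IsPos U n' q ∧ U.lab n' = Sum.inl f := by
  induction h generalizing n with
  | refl => exact ⟨n, hn, hf⟩
  | tail _ h ih =>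
    obtain ⟨h1, h2, u, v, hc, -⟩ := h
    have hm := hc.1.2.2.2
    obtain ⟨c, hcn, hcm, hp⟩ := hm.isPos_lift h1 hn
    exact ih hp (by rw [← hm.lab c hcn, hcm, hf])

theorem FoldBelowTG.isPos_unique {ar : F → ℕ} {p : List ℕ} {U W : PreGraph (F ⊕ V)} {n : ℕ}
    (h : Relation.ReflTransGen (FoldBelowTG ar p) U W) (hn : ∀ q, IsPos U n q ↔ q = p) :
    ∀ q, IsPos W n q ↔ q = p := by
  induction h with
  | refl => exact hn
  | tail _ h ih =>
    obtain ⟨h1, h2, u, v, hc, ⟨q1, hq1, -, hne1⟩, q2, hq2, -, hne2⟩ := h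
    have hm := hc.1.2.2.2
    have hnu : n ≠ u := fun h => hne1 ((ih q1).mp (h ▸ hq1)).symm
    have hnv : n ≠ v := fun h => hne2 ((ih q2).mp (h ▸ hq2)).symm
    intro q
    constructor
    · intro hq
      obtain ⟨c, -, hcm, hp⟩ := hm.isPos_lift h1 hq
      have hcu : c ≠ u := by
        intro hcu
        simp only [hcu, if_true] at hcm
        exact hnv hcm.symm
      simp only [hcu, if_false] at hcm
      subst hcm
      exact (ih q).mp hp
    · rintro rfl
      have := hm.isPos ((ih q).mpr rfl)
      simpa only [hnu, if_false] using this

/-! ### Graph rewrite steps -/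

theorem replaceAt_lab {S H : PreGraph L} {u x : ℕ} :
    (replaceAt S u H).lab x = if x ∈ H.nodes then H.lab x else S.lab x := rfl

theorem replaceAt_suc {S H : PreGraph L} {u x : ℕ} :
    (replaceAt S u H).suc x = if x ∈ H.nodes then H.suc x else
      (S.suc x).map fun y => if y = u then H.root else y := rfl

/-- Replacing the node `u` does not affect nodes from which `u` is not reachable. -/
theorem Represents.replaceAt_of_not_reach {ar : F → ℕ} {S H : PreGraph (F ⊕ V)}
    (hS : IsTermGraph ar S) {u a : ℕ} {t : Tm F V}
    (hH : ∀ x ∈ H.nodes, x ∈ S.nodes → H.lab x = S.lab x ∧ H.suc x = S.suc x)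
    (ha : a ∈ S.nodes) (hau : ¬ Reach S a u) (h : Represents S.suc S.lab a t) :
    Represents (replaceAt S u H).suc (replaceAt S u H).lab a t := by
  refine h.map (fun x => x ∈ S.nodes ∧ ¬ Reach S x u) id ?_ ?_ ⟨ha, hau⟩
  · rintro x ⟨hx, hxu⟩ y hy
    exact ⟨hS.closed x hx y hy, fun h => hxu (.head ⟨hx, hy⟩ h)⟩
  · rintro x ⟨hx, hxu⟩
    rw [id, List.map_id, replaceAt_lab, replaceAt_suc]
    by_cases hxH : x ∈ H.nodes
    · simpa [hxH] using hH x hxH hx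
    · simp only [hxH, if_false, true_and]
      conv_rhs => rw [← List.map_id (S.suc x)]
      refine List.map_congr_left fun y hy => ?_
      have : y ≠ u := fun h => hxu (.single ⟨hx, h ▸ hy⟩)
      simp [this]

/-- Replacing an unshared node `u` by `H` rewrites the term represented by any node
above `u`. -/
theorem rewriteAt_replaceAt {ar : F → ℕ} {R : Set (Tm F V × Tm F V)}
    {S H : PreGraph (F ⊕ V)} (hS : IsTermGraph ar S) {u : ℕ} {p : List ℕ}
    (hH : ∀ x ∈ H.nodes, x ∈ S.nodes →
      (H.lab x = S.lab x ∧ H.suc x = S.suc x) ∧ ¬ Reach S x u)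
    (hu : ∀ q, IsPos S u q ↔ q = p) {l r : Tm F V}
    (hl : Represents S.suc S.lab u l)
    (hr : Represents (replaceAt S u H).suc (replaceAt S u H).lab H.root r)
    (hlr : RewriteAt R [] l r) {a : ℕ} {q : List ℕ} (haq : ReachesP S a q u) {p' : List ℕ}
    (hap : IsPos S a p') {t : Tm F V} (ht : Represents S.suc S.lab a t) :
    ∃ t', RewriteAt R q t t' ∧ Represents (replaceAt S u H).suc (replaceAt S u H).lab
      (if a = u then H.root else a) t' := by
  induction haq generalizing p' t with
  | nil u =>
    rw [ht.unique hl]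
    exact ⟨r, hlr, by simpa using hr⟩
  | @cons a b u i q ha hi hbu ih =>
    have hau : Relation.TransGen (Edge S) a u := (ReachesP.cons ha hi hbu).transGen
    have hne : a ≠ u := hS.acyclic _ _ hau
    have haH : a ∉ H.nodes := fun h => (hH a h ha).2 (ReachesP.cons ha hi hbu).reach
    cases ht with
    | var hx =>
      rw [hS.varSuc a ha _ hx] at hi
      simp at hi
    | @app _ f ts hf hlen hch =>
      obtain ⟨hlt, hget⟩ := List.getElem?_eq_some_iff.mp hi
      have hlt' : i < ts.length := hlen ▸ hlt
      have hti : ts[i]? = some ts[i] := List.getElem?_eq_getElem hlt'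
      obtain ⟨t', hrew, hrep⟩ := ih hH hu hl hr (ReachesP.snoc hap ha hi) (hch i b _ hi hti)
      refine ⟨_, .congr hti hrew, ?_⟩
      rw [if_neg hne]
      refine .app ?_ ?_ ?_
      · rw [replaceAt_lab, if_neg haH, hf]
      · rw [replaceAt_suc, if_neg haH]
        simp [hlen]
      · intro j v s hv hs
        rw [replaceAt_suc, if_neg haH, List.getElem?_map, Option.map_eq_some_iff] at hv
        obtain ⟨c, hc, rfl⟩ := hv
        by_cases hji : i = j
        · subst hji
          rw [hi] at hc
          cases hc
          rw [List.getElem?_set_self hlt'] at hs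
          cases hs
          exact hrep
        · rw [List.getElem?_set_ne hji] at hs
          have hcu : ¬ Reach S c u := by
            intro h
            obtain ⟨q', hq'⟩ := h.exists_reachesP
            have e1 := (hu _).mp (ReachesP.append hap (.cons ha hi hbu))
            have e2 := (hu _).mp (ReachesP.append hap (.cons ha hc hq'))
            have := List.append_cancel_left (e1.trans e2.symm)
            exact hji (List.cons.inj this).1
          have hcu' : c ≠ u := fun h => hcu (h ▸ .refl)
          rw [if_neg hcu']
          exact (hch j c s hc hs).replaceAt_of_not_reach hS (fun x hx hx' => (hH x hx hx').1)
            (hS.closed a ha c (List.mem_of_getElem? hc)) hcu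

theorem subgraph_closed {G : PreGraph L} {u : ℕ}
    (hG : ∀ x ∈ G.nodes, ∀ y ∈ G.suc x, y ∈ G.nodes) :
    ∀ x ∈ (subgraph G u).nodes, ∀ y ∈ (subgraph G u).suc x, y ∈ (subgraph G u).nodes := by
  classical
  intro x hx y hy
  simp only [subgraph, Finset.mem_filter] at hx hy ⊢
  exact ⟨hG x hx.1 y hy, hx.2.tail ⟨hx.1, hy⟩⟩

theorem IsTermGraph.edge_fun {ar : F → ℕ} {G : PreGraph (F ⊕ V)} (hG : IsTermGraph ar G)
    {a b : ℕ} (h : Edge G a b) : ∃ f, G.lab a = Sum.inl f := by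
  cases hl : G.lab a with
  | inl f => exact ⟨f, rfl⟩
  | inr x =>
    have := h.2
    rw [hG.varSuc a h.1 x hl] at this
    simp at this

/-- A graph rewrite step with a rule simulating `l → r` at an unshared node simulates a
rewrite step. -/
theorem rewriteAt_of_simRule [Inhabited V] {ar : F → ℕ} {R : Set (Tm F V × Tm F V)}
    {l r : Tm F V} (hlr : (l, r) ∈ R) {Lg Rg L' R' S : PreGraph (F ⊕ V)}
    (hrule : SimRule ar l r Lg Rg) (hren : IsRenaming Lg Rg L' R' S)
    (hS : IsTermGraph ar S) {u : ℕ} {p : List ℕ} (hu : ∀ q, IsPos S u q ↔ q = p)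
    {m : ℕ → ℕ} (hm : IsMorphism L' (subgraph S u) m) :
    RewriteAt R p (termOf S) (termOf (replaceAt S u (applyMorph L'.nodes m S R'))) := by
  classical
  obtain ⟨hR, ⟨hL, -, hLt⟩, ⟨hRg, -, hRt⟩, hcommon⟩ := hrule
  obtain ⟨φ, hinj, hφL, hφR, hdisj⟩ := hren
  set H := applyMorph L'.nodes m S R' with hHdef
  set μ : ℕ → ℕ := fun v => if v ∈ L'.nodes then m v else v with hμ
  have hupos : IsPos S u p := (hu p).mpr rfl
  have hφLmem : ∀ a ∈ Lg.nodes, φ a ∈ L'.nodes := fun a ha => by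
    rw [hφL.nodes]; exact Finset.mem_image_of_mem φ ha
  have hφRmem : ∀ a ∈ Rg.nodes, φ a ∈ R'.nodes := fun a ha => by
    rw [hφR.nodes]; exact Finset.mem_image_of_mem φ ha
  have hmS : ∀ a ∈ L'.nodes, m a ∈ S.nodes ∧ Reach S u (m a) := by
    intro a ha
    simpa [subgraph] using hm.maps a ha
  have hroot : m (φ Lg.root) = u := by rw [hφL.root]; exact hm.root
  have hfun : ∀ a f, a ∈ Lg.nodes → Lg.lab a = Sum.inl f →
      S.lab (m (φ a)) = Sum.inl f ∧ S.suc (m (φ a)) = (Lg.suc a).map (fun x => m (φ x)) := by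
    intro a f ha hf
    have hf' : L'.lab (φ a) = Sum.inl f := (hφL.lab a ha).trans hf
    refine ⟨hm.lab _ (hφLmem a ha) f hf', ?_⟩
    have := hm.suc _ (hφLmem a ha) f hf'
    rw [hφL.suc a ha, List.map_map] at this
    exact this
  have hbelow : ∀ a ∈ Lg.nodes, IsVarNode Lg a → Relation.TransGen (Edge S) u (m (φ a)) := by
    intro a ha hav
    have hne : Lg.root ≠ a := fun h => hR.rootNotVar (h ▸ hav)
    rcases Relation.reflTransGen_iff_eq_or_transGen.mp (hL.rootReach a ha) with h | h
    · exact absurd h.symm hne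
    · rw [← hroot]
      refine Relation.TransGen.lift (fun x => m (φ x)) (fun x y hxy => ?_) _ _ h
      obtain ⟨f, hf⟩ := hL.edge_fun hxy
      refine ⟨(hmS _ (hφLmem x hxy.1)).1, ?_⟩
      rw [(hfun x f hxy.1 hf).2]
      exact List.mem_map_of_mem hxy.2
  have hRcase : ∀ b ∈ Rg.nodes,
      (∃ x, Rg.lab b = Sum.inr x ∧ b ∈ Lg.nodes ∧ Lg.lab b = Sum.inr x ∧ μ (φ b) = m (φ b)) ∨
      (∃ f, Rg.lab b = Sum.inl f ∧ μ (φ b) = φ b ∧ φ b ∉ S.nodes) := by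
    intro b hb
    cases hl : Rg.lab b with
    | inr x =>
      have hbL : b ∈ Lg.nodes := ((hcommon b).mpr ⟨hb, x, hl⟩).1
      exact .inl ⟨x, rfl, hbL, (hR.sharing b hbL hb).1.trans hl, if_pos (hφLmem b hbL)⟩
    | inl f =>
      refine .inr ⟨f, rfl, if_neg ?_, ?_⟩
      · intro hmem
        rw [hφL.nodes, Finset.mem_image] at hmem
        obtain ⟨a, ha, hab⟩ := hmem
        have : a = b := hinj (by simp [ha]) (by simp [hb]) hab
        subst this
        obtain ⟨x, hx⟩ := ((hcommon a).mp ⟨ha, hb⟩).2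
        rw [hl] at hx
        cases hx
      · exact Finset.disjoint_left.mp hdisj (Finset.mem_union_right _ (hφRmem b hb))
  have hHnodes : ∀ x, x ∈ H.nodes ↔ ∃ b ∈ Rg.nodes, μ (φ b) = x := by
    intro x
    simp only [hHdef, applyMorph, hφR.nodes, Finset.mem_image, hμ]
    constructor
    · rintro ⟨_, ⟨b, hb, rfl⟩, h⟩
      exact ⟨b, hb, h⟩
    · rintro ⟨b, hb, h⟩
      exact ⟨_, ⟨b, hb, rfl⟩, h⟩
  have hHroot : H.root = μ (φ Rg.root) := by
    rw [hφR.root]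
    rfl
  have hHS : ∀ x ∈ H.nodes, x ∈ S.nodes →
      (H.lab x = S.lab x ∧ H.suc x = S.suc x) ∧ ¬ Reach S x u := by
    intro x hx hxS
    refine ⟨⟨if_pos hxS, if_pos hxS⟩, ?_⟩
    obtain ⟨b, hb, rfl⟩ := (hHnodes x).mp hx
    rcases hRcase b hb with ⟨z, -, hbL, hz, he⟩ | ⟨f, -, he, hnS⟩
    · rw [he]
      exact hS.not_reach_of_transGen (hbelow b hbL ⟨z, hz⟩)
    · exact absurd (he ▸ hxS) hnS
  have hσ : ∀ x, ∃ t, ∀ a ∈ Lg.nodes, Lg.lab a = Sum.inr x →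
      Represents S.suc S.lab (m (φ a)) t := by
    intro x
    by_cases h : ∃ a ∈ Lg.nodes, Lg.lab a = Sum.inr x
    · obtain ⟨a, ha, hax⟩ := h
      obtain ⟨t, ht⟩ := hS.exists_represents (hmS _ (hφLmem a ha)).1
      exact ⟨t, fun b hb hbx => hL.varShared a ha b hb x hax hbx ▸ ht⟩
    · exact ⟨.var x, fun a ha hax => absurd ⟨a, ha, hax⟩ h⟩
  choose σ hσ using hσ
  have hredex : Represents S.suc S.lab u (substTm σ l) := by
    rw [← hroot, ← hLt]
    exact hL.represents_termOf.map_subst (· ∈ Lg.nodes) (fun x => m (φ x)) σ hL.closed hfun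
      (fun a x ha hx => hσ x a ha hx) hL.rootMem
  have hcontract : Represents (replaceAt S u H).suc (replaceAt S u H).lab H.root
      (substTm σ r) := by
    rw [hHroot, ← hRt]
    refine hRg.represents_termOf.map_subst (· ∈ Rg.nodes) (fun x => μ (φ x)) σ hRg.closed
      ?_ ?_ hRg.rootMem
    · intro b f hb hf
      have hbH : μ (φ b) ∈ H.nodes := (hHnodes _).mpr ⟨b, hb, rfl⟩
      rw [replaceAt_lab, replaceAt_suc, if_pos hbH, if_pos hbH]
      rcases hRcase b hb with ⟨z, hz, -⟩ | ⟨g, -, he, hnS⟩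
      · rw [hf] at hz
        cases hz
      · rw [he]
        simp only [hHdef, applyMorph, if_neg hnS]
        refine ⟨(hφR.lab b hb).trans hf, ?_⟩
        rw [hφR.suc b hb, List.map_map]
        rfl
    · intro b x hb hx
      rcases hRcase b hb with ⟨z, hz, hbL, hbz, he⟩ | ⟨g, hg, -⟩
      · rw [hx] at hz
        cases hz
        simp only [he]
        exact (hσ x b hbL hbz).replaceAt_of_not_reach hS (fun y hy hy' => (hHS y hy hy').1)
          (hmS _ (hφLmem b hbL)).1 (hS.not_reach_of_transGen (hbelow b hbL ⟨x, hbz⟩))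
      · rw [hx] at hg
        cases hg
  obtain ⟨t', hrew, hrep⟩ := rewriteAt_replaceAt hS hHS hu hredex hcontract (.root σ hlr)
    hupos (.nil _) hS.represents_termOf
  have hHrootMem : H.root ∈ H.nodes := (hHnodes _).mpr ⟨_, hRg.rootMem, hHroot.symm⟩
  have hclosed : ∀ x ∈ (gUnion H (redirect S u H.root)).nodes,
      ∀ y ∈ (gUnion H (redirect S u H.root)).suc x,
        y ∈ (gUnion H (redirect S u H.root)).nodes := by
    intro x hx y hy
    by_cases hxH : x ∈ H.nodes
    · simp only [gUnion, hxH, if_true] at hy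
      by_cases hxS : x ∈ S.nodes
      · obtain ⟨⟨-, hs⟩, hnr⟩ := hHS x hxH hxS
        rw [hs] at hy
        have hyu : y ≠ u := fun h => hnr (.single ⟨hxS, h ▸ hy⟩)
        simp [gUnion, redirect, hyu, hS.closed x hxS y hy]
      · obtain ⟨b, hb, rfl⟩ := (hHnodes x).mp hxH
        rcases hRcase b hb with ⟨z, -, hbL, -, he⟩ | ⟨f, -, he, hnS⟩
        · exact absurd (he ▸ (hmS _ (hφLmem b hbL)).1) hxS
        · rw [he] at hy
          simp only [hHdef, applyMorph, if_neg hnS] at hy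
          rw [hφR.suc b hb, List.map_map, List.mem_map] at hy
          obtain ⟨c, hc, rfl⟩ := hy
          exact Finset.mem_union_left _ ((hHnodes _).mpr ⟨c, hRg.closed b hb c hc, rfl⟩)
    · have hxS : x ∈ S.nodes := by
        have hxr : x ≠ H.root := fun h => hxH (h ▸ hHrootMem)
        have : x = H.root ∨ x ∈ H.nodes ∨ x ≠ u ∧ x ∈ S.nodes := by
          simpa [gUnion, redirect] using hx
        tauto
      simp only [gUnion, redirect, hxH, if_false, List.mem_map] at hy
      obtain ⟨z, hz, rfl⟩ := hy
      by_cases hzu : z = u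
      · simp [gUnion, hzu, hHrootMem]
      · simp [gUnion, redirect, hzu, hS.closed x hxS z hz]
  have hrootMem : (replaceAt S u H).root ∈ (replaceAt S u H).nodes := by
    simp only [replaceAt, subgraph, Finset.mem_filter]
    refine ⟨?_, .refl⟩
    by_cases h : u = S.root
    · simp [gUnion, h, hHrootMem]
    · simp [gUnion, redirect, h, Ne.symm h, hS.rootMem]
  have hTroot : (replaceAt S u H).root = if S.root = u then H.root else S.root := by
    simp only [replaceAt, subgraph, eq_comm]
  rw [← hTroot] at hrep
  have hTclosed : ∀ x ∈ (replaceAt S u H).nodes, ∀ y ∈ (replaceAt S u H).suc x,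
      y ∈ (replaceAt S u H).nodes := subgraph_closed hclosed
  rwa [hrep.termOf_eq hTclosed hrootMem]

/-- Adequacy, soundness direction: If `S ▷_p^! U`, `U ⊐_p^! V`
and `V ⇒_{G(R),p} T`, then `term(S) →_{R,p} term(T)`. -/
theorem adequacy_soundness {F V : Type} [Inhabited V] (ar : F → ℕ)
    (R : Set (Tm F V × Tm F V)) (hR : IsTRS R)
    (G : Set (PreGraph (F ⊕ V) × PreGraph (F ⊕ V))) (hG : IsSimGRS ar R G)
    (S U Vg T : PreGraph (F ⊕ V)) (hS : IsTermGraph ar S)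
    (s : Tm F V) (hs : termOf S = s) (p : List ℕ)
    (h1 : NormTo (UnfoldAboveTG ar p) S U)
    (h2 : NormTo (FoldBelowTG ar p) U Vg)
    (h3 : GStepP G p Vg T) :
    RewriteAt R p s (termOf T) := by
  obtain ⟨u, hpu, ⟨Lg, Rg⟩, hLR, L', R', m, hren, hm, rfl⟩ := h3
  obtain ⟨⟨l, r⟩, hlr, hrule⟩ := hG.2 _ hLR
  obtain ⟨hU, htU⟩ := UnfoldAboveTG.reflTransGen_inv hS h1.1
  obtain ⟨hV, htV⟩ := FoldBelowTG.reflTransGen_inv hU h2.1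
  obtain ⟨f, hf⟩ : ∃ f, Vg.lab u = Sum.inl f := by
    obtain ⟨φ, -, hφ, -⟩ := hren
    cases hl : Lg.lab Lg.root with
    | inr x => exact absurd ⟨x, hl⟩ hrule.1.rootNotVar
    | inl f =>
      have hmem : Lg.root ∈ Lg.nodes := hrule.1.lhs.rootMem
      have hmem' : L'.root ∈ L'.nodes := by
        rw [hφ.nodes, ← hφ.root]
        exact Finset.mem_image_of_mem φ hmem
      have h := hm.lab _ hmem' f (by rw [← hφ.root, hφ.lab _ hmem, hl])
      rw [hm.root] at h
      exact ⟨f, h⟩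
  obtain ⟨n, hn, hnf⟩ := FoldBelowTG.isPos_lift h2.1 hpu hf
  have hnp := FoldBelowTG.isPos_unique h2.1 (p := p) (n := n) fun q =>
    ⟨isPos_unique_of_unfold_minimal hU h1.2 List.prefix_rfl hn hnf q, fun h => h ▸ hn⟩
  obtain rfl : n = u := ((hnp p).mpr rfl).unique hpu
  rw [← hs, ← htU, ← htV]
  exact rewriteAt_of_simRule hlr hrule hren hV hnp hm

end TermGraphs
end

section
/- Single-step folding preserves positions: if S ⊐_{u,v} T for a term graph S and nodes u, v, then Pos(S) = Pos(T), i.e. the sets of positions of S and T coincide. -/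
namespace TermGraphs

variable {F V L : Type}

/-- If all successors stay inside the node set, a morphism `m` with `S ≥_m T`
preserves and reflects the positions below each node. -/
theorem IsGeMorph.exists_reachesP_iff {F V : Type} {S T : PreGraph (F ⊕ V)} {m : ℕ → ℕ}
    (hm : IsGeMorph S T m) (closed : ∀ u ∈ S.nodes, ∀ v ∈ S.suc u, v ∈ S.nodes)
    (p : List ℕ) {a : ℕ} (ha : a ∈ S.nodes) :
    (∃ w, ReachesP S a p w) ↔ ∃ w, ReachesP T (m a) p w := by
  induction p generalizing a with
  | nil => exact ⟨fun _ => ⟨_, .nil _⟩, fun _ => ⟨_, .nil _⟩⟩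
  | cons i p ih =>
    constructor
    · rintro ⟨w, hw⟩
      cases hw with
      | @cons _ b _ _ _ _ hb hw =>
        obtain ⟨w', hw'⟩ := (ih (closed a ha b (List.mem_of_getElem? hb))).1 ⟨w, hw⟩
        exact ⟨w', .cons (hm.maps a ha) (by simp [hm.suc a ha, hb]) hw'⟩
    · rintro ⟨w, hw⟩
      cases hw with
      | cons _ hb hw =>
        rw [hm.suc a ha, List.getElem?_map, Option.map_eq_some_iff] at hb
        obtain ⟨b, hb, rfl⟩ := hb
        obtain ⟨w', hw'⟩ := (ih (closed a ha b (List.mem_of_getElem? hb))).2 ⟨w, hw⟩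
        exact ⟨w', .cons ha hb hw'⟩

/-- Single-step folding preserves positions: if `S ⊐_{u,v} T`
for a term graph `S`, then `Pos(S) = Pos(T)`. -/
theorem collapse_preserves_positions {F V : Type} (ar : F → ℕ)
    (S T : PreGraph (F ⊕ V)) (hS : IsTermGraph ar S)
    (u v : ℕ) (h : CollapseS S T u v) :
    ∀ p : List ℕ, (∃ w, IsPos S w p) ↔ (∃ w, IsPos T w p) := by
  intro p
  have hm := h.1.2.2.2
  have := hm.exists_reachesP_iff hS.closed p hS.rootMem
  rwa [hm.root] at this

end TermGraphs
end
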